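/- Let b ∈ ℝ. There exists a compact continuous linear operator Q : L²(ℝ,ℂ) → L²(ℝ,ℂ) such that for every v ∈ L²(ℝ,ℂ) and almost every ξ ∈ ℝ, (Q v)(ξ) = (b−3)·∫_ℝ ( K₁(ξ,η) − 2·K₂(ξ,η) )·v(η) dη, where K₁(ξ,η) = −2·sgn(η)·exp(−|ξ−η| − 2|η|) and K₂(ξ,η) = −sgn(ξ−η)·exp(−|ξ−η| − 2|η|). -/

import Mathlib

open MeasureTheory

/-- The kernel `K₁(ξ,η) = -2·sgn(η)·exp(-|ξ-η| - 2|η|)`. -/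
noncomputable def K1 (ξ η : ℝ) : ℝ := -2 * Real.sign η * Real.exp (-|ξ - η| - 2 * |η|)

/-- The kernel `K₂(ξ,η) = -sgn(ξ-η)·exp(-|ξ-η| - 2|η|)`. -/
noncomputable def K2 (ξ η : ℝ) : ℝ := -Real.sign (ξ - η) * Real.exp (-|ξ - η| - 2 * |η|)


namespace QAux

/-- `L²(ℝ,ℂ)`. -/
noncomputable abbrev H := Lp ℂ 2 (volume : Measure ℝ)

/-- Integral operator attached to a square integrable family of functionals. -/
noncomputable def T : Lp (H →L[ℂ] ℂ) 2 (volume : Measure ℝ) →L[ℂ] (H →L[ℂ] H) :=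
  (ContinuousLinearMap.compLpL₂ 2 (volume : Measure ℝ)
    (ContinuousLinearMap.id ℂ (H →L[ℂ] ℂ)).flip).flip

lemma T_ae (G : Lp (H →L[ℂ] ℂ) 2 (volume : Measure ℝ)) (v : H) :
    ∀ᵐ ξ : ℝ, (T G v : ℝ → ℂ) ξ = G ξ v := by
  have := ContinuousLinearMap.coeFn_compLp ((ContinuousLinearMap.id ℂ (H →L[ℂ] ℂ)).flip v) G
  exact this

lemma T_compact (G : Lp (H →L[ℂ] ℂ) 2 (volume : Measure ℝ)) : IsCompactOperator (T G) := by
  have h2 : (2 : ENNReal) ≠ ⊤ := by norm_num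
  induction G using Lp.induction h2 with
  | indicatorConst c hs hμs =>
    have h1 : T (Lp.simpleFunc.indicatorConst 2 hs hμs.ne c : Lp (H →L[ℂ] ℂ) 2 (volume : Measure ℝ))
        = (ContinuousLinearMap.toSpanSingleton ℂ (indicatorConstLp 2 hs hμs.ne (1:ℂ))).comp c := by
      ext1 v
      apply Lp.ext
      rw [Lp.simpleFunc.coe_indicatorConst]
      filter_upwards [T_ae (indicatorConstLp 2 hs hμs.ne c) v,
        indicatorConstLp_coeFn (p := 2) (hs := hs) (hμs := hμs.ne) (c := c),
        indicatorConstLp_coeFn (p := 2) (hs := hs) (hμs := hμs.ne) (c := (1:ℂ)),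
        Lp.coeFn_smul (c v) (indicatorConstLp 2 hs hμs.ne (1:ℂ))] with x h1 h2 h3 h4
      rw [h1, h2]
      simp only [ContinuousLinearMap.comp_apply, ContinuousLinearMap.toSpanSingleton_apply]
      rw [h4, Pi.smul_apply, h3]
      simp only [Set.indicator]
      split_ifs <;> simp
    rw [h1]
    have : IsCompactOperator c := isCompactOperator_of_locallyCompactSpace_dom c
    exact this.clm_comp (ContinuousLinearMap.toSpanSingleton ℂ (indicatorConstLp 2 hs hμs.ne (1:ℂ)))
  | add hf hg _ h1 h2 =>
    rw [map_add]
    exact h1.add h2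
  | isClosed =>
    exact (isClosed_setOfPred_isCompactOperator (𝕜₁ := ℂ) (σ₁₂ := RingHom.id ℂ)
      (M₁ := H) (M₂ := H)).preimage T.continuous

/-- the full kernel -/
noncomputable def k (ξ η : ℝ) : ℂ := ((K1 ξ η - 2 * K2 ξ η : ℝ) : ℂ)

lemma abs_sign_le (x : ℝ) : |Real.sign x| ≤ 1 := by
  rcases Real.sign_apply_eq x with h | h | h <;> rw [h] <;> simp

lemma measurable_sign : Measurable Real.sign := by
  unfold Real.sign
  exact Measurable.ite measurableSet_Iio measurable_const
    (Measurable.ite measurableSet_Ioi measurable_const measurable_const)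

lemma k_bound (ξ η : ℝ) : ‖k ξ η‖ ≤ 4 * Real.exp (-|ξ|) * Real.exp (-|η|) := by
  have e : k ξ η = (((-2 * Real.sign η + 2 * Real.sign (ξ - η)) *
      Real.exp (-|ξ - η| - 2 * |η|) : ℝ) : ℂ) := by
    unfold k K1 K2; congr 1; ring
  rw [e, Complex.norm_real, norm_mul, Real.norm_eq_abs, Real.norm_eq_abs, Real.abs_exp, mul_assoc,
    ← Real.exp_add]
  have h1 := abs_le.1 (abs_sign_le η)
  have h2 := abs_le.1 (abs_sign_le (ξ - η))
  have h3 : |ξ| ≤ |ξ - η| + |η| := by simpa using abs_add_le (ξ - η) η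
  gcongr
  · exact abs_le.2 ⟨by linarith, by linarith⟩
  · linarith

lemma k_meas (ξ : ℝ) : Measurable (k ξ) := by
  unfold k K1 K2
  have h1 : Measurable fun η : ℝ => Real.sign η := measurable_sign
  have h2 : Measurable fun η : ℝ => Real.sign (ξ - η) :=
    measurable_sign.comp (measurable_const.sub measurable_id)
  fun_prop

lemma integrable_exp_abs : Integrable (fun x : ℝ => Real.exp (-(2 * |x|))) := by
  have h : IntegrableOn (fun x : ℝ => Real.exp (-(2 * x))) (Set.Ioi 0) := by
    have := integrableOn_exp_mul_Ioi (a := -2) (by norm_num) 0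
    simpa using this
  have h' : IntegrableOn (fun x : ℝ => Real.exp (2 * x)) (Set.Iic 0) :=
    integrableOn_exp_mul_Iic (a := 2) (by norm_num) 0
  rw [← integrableOn_univ, ← Set.Iic_union_Ioi (a := (0:ℝ))]
  refine IntegrableOn.union (h'.congr_fun (fun x hx => ?_) measurableSet_Iic)
    (h.congr_fun (fun x hx => ?_) measurableSet_Ioi)
  · simp only [abs_of_nonpos (Set.mem_Iic.1 hx)]; ring_nf
  · simp only [abs_of_pos (Set.mem_Ioi.1 hx)]

lemma memLp_exp : MemLp (fun x : ℝ => Real.exp (-|x|)) 2 volume := by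
  rw [memLp_two_iff_integrable_sq (by fun_prop)]
  convert integrable_exp_abs using 2 with x
  rw [← Real.exp_nat_mul]; congr 1; push_cast; ring

lemma k_memLp (ξ : ℝ) : MemLp (k ξ) 2 volume := by
  refine MemLp.of_le_mul (c := 4 * Real.exp (-|ξ|)) memLp_exp (k_meas ξ).aestronglyMeasurable ?_
  filter_upwards with η
  rw [Real.norm_eq_abs, Real.abs_exp]
  exact k_bound ξ η

/-- slices of the kernel, in `L²` -/
noncomputable def kL (ξ : ℝ) : H := (k_memLp ξ).toLp (k ξ)

lemma norm_kL_le : ∀ ξ, ‖kL ξ‖ ≤ 4 * Real.exp (-|ξ|) * ‖memLp_exp.toLp _‖ := by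
  intro ξ
  refine Lp.norm_le_mul_norm_of_ae_le_mul ?_
  filter_upwards [(k_memLp ξ).coeFn_toLp, memLp_exp.coeFn_toLp] with η h1 h2
  rw [kL, h1, h2, Real.norm_eq_abs, Real.abs_exp]
  exact k_bound ξ η

lemma sign_continuousAt {x : ℝ} (hx : x ≠ 0) : ContinuousAt Real.sign x := by
  rcases lt_or_gt_of_ne hx with h | h
  · refine (continuousAt_const (y := (-1:ℝ))).congr ?_
    filter_upwards [Iio_mem_nhds h] with y hy
    exact (Real.sign_of_neg hy).symm
  · refine (continuousAt_const (y := (1:ℝ))).congr ?_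
    filter_upwards [Ioi_mem_nhds h] with y hy
    exact (Real.sign_of_pos hy).symm

lemma k_contAt {ξ η : ℝ} (h : η ≠ ξ) : ContinuousAt (fun x => k x η) ξ := by
  unfold k K1 K2
  have h2 : ContinuousAt (fun x : ℝ => Real.sign (x - η)) ξ :=
    ContinuousAt.comp (f := fun x : ℝ => x - η) (g := Real.sign)
      (sign_continuousAt (sub_ne_zero.2 h.symm)) (by fun_prop)
  fun_prop

open Filter Topology in
lemma continuous_kL : Continuous kL := by
  rw [continuous_iff_continuousAt]
  intro ξ
  unfold ContinuousAt kL
  rw [Lp.tendsto_Lp_iff_tendsto_eLpNorm'']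
  simp_rw [eLpNorm_eq_lintegral_rpow_enorm_toReal (p := 2) (by norm_num) (by norm_num)]
  have key : Tendsto (fun x => ∫⁻ η, ‖(k x - k ξ) η‖ₑ ^ (ENNReal.toReal 2)) (𝓝 ξ)
      (𝓝 (∫⁻ η : ℝ, 0)) := by
    refine tendsto_lintegral_filter_of_dominated_convergence
      (fun η => ENNReal.ofReal (64 * Real.exp (-(2 * |η|)))) ?_ ?_ ?_ ?_
    · filter_upwards with x
      exact (((k_meas x).sub (k_meas ξ)).enorm).pow_const _
    · filter_upwards with x
      filter_upwards with η
      have h : ‖(k x - k ξ) η‖ ≤ 8 * Real.exp (-|η|) := by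
        have a1 := k_bound x η
        have a2 := k_bound ξ η
        have b1 : Real.exp (-|x|) ≤ 1 := Real.exp_le_one_iff.2 (by simp)
        have b2 : Real.exp (-|ξ|) ≤ 1 := Real.exp_le_one_iff.2 (by simp)
        have c := Real.exp_pos (-|η|)
        have d := norm_sub_le (k x η) (k ξ η)
        rw [Pi.sub_apply]
        nlinarith
      rw [← ofReal_norm, ENNReal.toReal_ofNat, ENNReal.ofReal_rpow_of_nonneg (norm_nonneg _) (by norm_num)]
      apply ENNReal.ofReal_le_ofReal
      rw [Real.rpow_two]
      calc _ ≤ (8 * Real.exp (-|η|)) ^ 2 := by gcongr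
        _ = _ := by
          rw [mul_pow, ← Real.exp_nat_mul]; push_cast; ring_nf
    · exact (integrable_exp_abs.const_mul 64).lintegral_lt_top.ne
    · have : ∀ᵐ η : ℝ, η ≠ ξ := by simp [ae_iff]
      filter_upwards [this] with η hη
      have h0 := ((k_contAt hη).sub (continuousAt_const (y := k ξ η))).enorm
      have h1 := (ENNReal.continuous_rpow_const (y := ENNReal.toReal 2)).continuousAt.comp h0
      have h2 := h1.tendsto
      simpa [Function.comp_def] using h2
  have h := (ENNReal.continuous_rpow_const (y := 1 / ENNReal.toReal 2)).continuousAt.tendsto.comp key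
  simpa [Function.comp_def] using h

lemma G_memLp : MemLp (fun ξ => innerSL ℂ (kL ξ)) 2 (volume : Measure ℝ) := by
  refine MemLp.of_le_mul (c := 4 * ‖memLp_exp.toLp _‖) memLp_exp
    ((innerSL ℂ).continuous.comp continuous_kL).aestronglyMeasurable ?_
  filter_upwards with ξ
  rw [innerSL_apply_norm, Real.norm_eq_abs, Real.abs_exp]
  linarith [norm_kL_le ξ]

lemma inner_kL (ξ : ℝ) (v : H) : innerSL ℂ (kL ξ) v = ∫ η, k ξ η * v η := by
  rw [innerSL_apply_apply, L2.inner_def]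
  apply integral_congr_ae
  filter_upwards [(k_memLp ξ).coeFn_toLp] with η h
  rw [kL, h]
  simp only [RCLike.inner_apply, k, Complex.conj_ofReal, mul_comm]

end QAux

/-- there is a compact continuous linear operator `Q` on `L²(ℝ,ℂ)` acting as
the integral operator with kernel `(b-3)·(K₁ - 2K₂)`. -/
theorem exists_compact_operator_Q (b : ℝ) :
    ∃ Q : Lp ℂ 2 (volume : Measure ℝ) →L[ℂ] Lp ℂ 2 (volume : Measure ℝ),
      IsCompactOperator Q ∧
      ∀ v : Lp ℂ 2 (volume : Measure ℝ),
        ∀ᵐ ξ : ℝ, (Q v : ℝ → ℂ) ξ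
          = ((b : ℂ) - 3) * ∫ η : ℝ, ((K1 ξ η - 2 * K2 ξ η : ℝ) : ℂ) * v η := by
  refine ⟨((b : ℂ) - 3) • QAux.T QAux.G_memLp.toLp, (QAux.T_compact QAux.G_memLp.toLp).smul ((b : ℂ) - 3), fun v => ?_⟩
  filter_upwards [QAux.T_ae QAux.G_memLp.toLp v, QAux.G_memLp.coeFn_toLp,
    Lp.coeFn_smul ((b : ℂ) - 3) (QAux.T QAux.G_memLp.toLp v)] with ξ h1 h2 h3
  rw [smul_apply, h3, Pi.smul_apply, h1, h2, QAux.inner_kL, smul_eq_mul]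
  rfl
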